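/- Existence of admissible data: for any two continuous paths of Lagrangian subspaces L1, L2 of a real symplectic vector space (E, ω) on an interval [a,b], there exist a partition a = t_0 ≤ t_1 ≤ … ≤ t_k = b and Lagrangian subspaces M_1, …, M_k of E such that for each ν ∈ {1,…,k}, M_ν ∩ L1(t) = {0} and M_ν ∩ L2(t) = {0} for all t ∈ [t_{ν−1}, t_ν]. -/

import Mathlib

open LinearMap (BilinForm)

variable {E : Type*} [NormedAddCommGroup E] [NormedSpace ℝ E]

/-- A subspace is Lagrangian iff it equals its symplectic orthogonal. -/
def IsLagrangian (ω : BilinForm ℝ E) (L : Submodule ℝ E) : Prop :=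
  LinearMap.BilinForm.orthogonal ω L = L

/-- Maximal dimension of a subspace on which the function `Q` is positive away from `0`. -/
noncomputable def posIndex {V : Type*} [AddCommGroup V] [Module ℝ V] (Q : V → ℝ) : ℕ :=
  sSup {d : ℕ | ∃ W : Submodule ℝ V, Module.finrank ℝ W = d ∧ ∀ x ∈ W, x ≠ 0 → 0 < Q x}

/-- The quadratic form `Q(L1,L2,L3)` of a triplet of subspaces,
`Q(x1,x2,x3) = ω(x1,x2) + ω(x2,x3) + ω(x3,x1)`. -/
def tripleQ (ω : BilinForm ℝ E) (L1 L2 L3 : Submodule ℝ E) (v : L1 × L2 × L3) : ℝ :=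
  ω v.1 v.2.1 + ω v.2.1 v.2.2 + ω v.2.2 v.1

/-- The signature `s(L1,L2,L3)` of a triplet of subspaces: the signature (number of positive
squares minus number of negative squares in a diagonalization) of `Q(L1,L2,L3)`. -/
noncomputable def tripleSig (ω : BilinForm ℝ E) (L1 L2 L3 : Submodule ℝ E) : ℤ :=
  (posIndex (tripleQ ω L1 L2 L3) : ℤ) - (posIndex (fun v => - tripleQ ω L1 L2 L3 v) : ℤ)

/-- A continuous path of Lagrangian subspaces of `(E, ω)` on the interval `[a,b]`:  a family
`(L t)` of Lagrangian subspaces such that every `t0 ∈ [a,b]` has a neighbourhood `U` in `[a,b]`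
on which there is a continuous family of idempotent linear maps of `E` with range `L t`. -/
structure IsLagrangianPath (ω : BilinForm ℝ E) (a b : ℝ) (L : ℝ → Submodule ℝ E) : Prop where
  lag : ∀ t ∈ Set.Icc a b, IsLagrangian ω (L t)
  locTriv : ∀ t0 ∈ Set.Icc a b, ∃ U ∈ nhdsWithin t0 (Set.Icc a b), U ⊆ Set.Icc a b ∧
    ∃ P : ℝ → E →L[ℝ] E, ContinuousOn P U ∧
      ∀ t ∈ U, (P t).comp (P t) = P t ∧ LinearMap.range (P t : E →ₗ[ℝ] E) = L t

/-- A jointly continuous two-parameter family `(L s t)`, `s ∈ [0,1]`, `t ∈ [a,b]`, of Lagrangian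
subspaces (a homotopy of paths of Lagrangian subspaces). -/
structure IsLagrangianHomotopy (ω : BilinForm ℝ E) (a b : ℝ)
    (L : ℝ → ℝ → Submodule ℝ E) : Prop where
  lag : ∀ s ∈ Set.Icc (0:ℝ) 1, ∀ t ∈ Set.Icc a b, IsLagrangian ω (L s t)
  locTriv : ∀ p ∈ Set.Icc (0:ℝ) 1 ×ˢ Set.Icc a b,
    ∃ U ∈ nhdsWithin p (Set.Icc (0:ℝ) 1 ×ˢ Set.Icc a b),
      U ⊆ Set.Icc (0:ℝ) 1 ×ˢ Set.Icc a b ∧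
      ∃ P : ℝ × ℝ → E →L[ℝ] E, ContinuousOn P U ∧
        ∀ q ∈ U, (P q).comp (P q) = P q ∧ LinearMap.range (P q : E →ₗ[ℝ] E) = L q.1 q.2

/-- Admissible data for a pair of paths of Lagrangian subspaces on `[a,b]`:  a partition
`a = t_0 ≤ t_1 ≤ … ≤ t_k = b` together with Lagrangian subspaces `M_1, …, M_k` such that
`M_ν ∩ L_i(t) = 0` for all `t ∈ [t_{ν-1}, t_ν]`, `i = 1,2`.  (Here `M (ν+1)` plays the role
of `M_{ν+1}` for `0 ≤ ν < k`.) -/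
structure AdmissibleData (ω : BilinForm ℝ E) (a b : ℝ) (L1 L2 : ℝ → Submodule ℝ E) where
  k : ℕ
  kpos : 0 < k
  t : ℕ → ℝ
  M : ℕ → Submodule ℝ E
  ht0 : t 0 = a
  htk : t k = b
  hmono : ∀ ν < k, t ν ≤ t (ν + 1)
  hlag : ∀ ν < k, IsLagrangian ω (M (ν + 1))
  htrans1 : ∀ ν < k, ∀ s ∈ Set.Icc (t ν) (t (ν + 1)), M (ν + 1) ⊓ L1 s = ⊥
  htrans2 : ∀ ν < k, ∀ s ∈ Set.Icc (t ν) (t (ν + 1)), M (ν + 1) ⊓ L2 s = ⊥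

/-- The expression `(1/2) Σ_ν ( s(L1(t_{ν-1}), L2(t_{ν-1}), M_ν) − s(L1(t_ν), L2(t_ν), M_ν) )`
computed from admissible data; by well-definedness this is the intersection number `[L1 : L2]`. -/
noncomputable def dataSum {ω : BilinForm ℝ E} {a b : ℝ} {L1 L2 : ℝ → Submodule ℝ E}
    (D : AdmissibleData ω a b L1 L2) : ℝ :=
  (1 / 2 : ℝ) * ∑ ν ∈ Finset.range D.k,
    ((tripleSig ω (L1 (D.t ν)) (L2 (D.t ν)) (D.M (ν + 1)) : ℝ)
      - (tripleSig ω (L1 (D.t (ν + 1))) (L2 (D.t (ν + 1))) (D.M (ν + 1)) : ℝ))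

/-- A continuous path of symplectic automorphisms of `(E, ω)` on `[a,b]`. -/
structure IsSymplecticPath (ω : BilinForm ℝ E) (a b : ℝ) (A : ℝ → E →L[ℝ] E) : Prop where
  bij : ∀ t ∈ Set.Icc a b, Function.Bijective (A t)
  symp : ∀ t ∈ Set.Icc a b, ∀ x y, ω (A t x) (A t y) = ω x y
  cont : ContinuousOn A (Set.Icc a b)

/-- The symplectic form of `E × E⁻`: `((x1,x2),(y1,y2)) ↦ ω(x1,y1) − ω(x2,y2)`. -/
noncomputable def prodNegForm (ω : BilinForm ℝ E) : BilinForm ℝ (E × E) :=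
  LinearMap.mk₂ ℝ (fun x y => ω x.1 y.1 - ω x.2 y.2)
    (fun x x' y => by simp only [Prod.fst_add, Prod.snd_add, map_add, LinearMap.add_apply]; ring)
    (fun c x y => by
      simp only [Prod.smul_fst, Prod.smul_snd, map_smul, LinearMap.smul_apply, smul_eq_mul]; ring)
    (fun x y y' => by simp only [Prod.fst_add, Prod.snd_add, map_add]; ring)
    (fun c x y => by simp only [Prod.smul_fst, Prod.smul_snd, map_smul, smul_eq_mul]; ring)

/-- The graph `Γ_A = {(A x, x)}` of an endomorphism, as a subspace of `E × E`. -/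
def graphSub (A : E →L[ℝ] E) : Submodule ℝ (E × E) :=
  LinearMap.range ((A : E →ₗ[ℝ] E).prod LinearMap.id)

/-- The diagonal `Δ = {(x, x)}` in `E × E`. -/
def diagSub : Submodule ℝ (E × E) :=
  LinearMap.range ((LinearMap.id : E →ₗ[ℝ] E).prod LinearMap.id)

theorem Submodule.sup_span_singleton_inf_eq_bot {M L : Submodule ℝ E} (hML : M ⊓ L = ⊥) {x : E}
    (hx : x ∉ M ⊔ L) : (M ⊔ Submodule.span ℝ {x}) ⊓ L = ⊥ := by
  rw [Submodule.eq_bot_iff]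
  rintro y ⟨hyM, hyL⟩
  obtain ⟨m, hm, z, hz, rfl⟩ := Submodule.mem_sup.1 hyM
  obtain ⟨c, rfl⟩ := Submodule.mem_span_singleton.1 hz
  have hc : c = 0 := by
    by_contra hc
    refine hx ?_
    have hcx : c • x ∈ M ⊔ L := by
      have := (M ⊔ L).sub_mem (Submodule.mem_sup_right hyL) (Submodule.mem_sup_left hm)
      simpa using this
    exact ((M ⊔ L).smul_mem_iff hc).1 hcx
  subst hc
  simp only [zero_smul, add_zero] at hyL ⊢
  have : m ∈ M ⊓ L := ⟨hm, hyL⟩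
  simpa [hML] using this

/-- A linear space is not the union of two subspaces neither of which contains it. -/
theorem Submodule.exists_mem_notMem_notMem {V A B : Submodule ℝ E} (hA : ¬ V ≤ A)
    (hB : ¬ V ≤ B) : ∃ x ∈ V, x ∉ A ∧ x ∉ B := by
  obtain ⟨u, huV, huA⟩ := SetLike.not_le_iff_exists.1 hA
  obtain ⟨v, hvV, hvB⟩ := SetLike.not_le_iff_exists.1 hB
  by_cases huB : u ∈ B
  · by_cases hvA : v ∈ A
    · exact ⟨u + v, V.add_mem huV hvV, fun h => huA ((A.add_mem_iff_left hvA).1 h),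
        fun h => hvB ((B.add_mem_iff_right huB).1 h)⟩
    · exact ⟨v, hvV, hvA, hvB⟩
  · exact ⟨u, huV, huA, huB⟩

theorem le_orthogonal_sup_span_singleton {ω : BilinForm ℝ E}
    (halt : LinearMap.IsAlt ω) {M : Submodule ℝ E}
    (hM : M ≤ LinearMap.BilinForm.orthogonal ω M) {x : E}
    (hx : x ∈ LinearMap.BilinForm.orthogonal ω M) :
    M ⊔ Submodule.span ℝ {x} ≤
      LinearMap.BilinForm.orthogonal ω (M ⊔ Submodule.span ℝ {x}) := by
  intro y hy z hz
  obtain ⟨m, hm, _, hc, rfl⟩ := Submodule.mem_sup.1 hy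
  obtain ⟨c, rfl⟩ := Submodule.mem_span_singleton.1 hc
  obtain ⟨m', hm', _, hd, rfl⟩ := Submodule.mem_sup.1 hz
  obtain ⟨d, rfl⟩ := Submodule.mem_span_singleton.1 hd
  have h1 : ω m' m = 0 := hM hm m' hm'
  have h2 : ω m' x = 0 := hx m' hm'
  have h3 : ω x m = 0 := halt.isRefl _ _ (hx m hm)
  have h4 : ω x x = 0 := halt x
  simp [h1, h2, h3, h4]

section Lagrangian

variable [FiniteDimensional ℝ E] {ω : BilinForm ℝ E}

/-- An isotropic subspace `M` transverse to a Lagrangian `L` is Lagrangian as soon as its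
symplectic orthogonal is contained in `M ⊔ L`. -/
theorem IsLagrangian.of_orthogonal_le_sup (halt : LinearMap.IsAlt ω)
    (hnd : LinearMap.BilinForm.Nondegenerate ω) {M L : Submodule ℝ E} (hL : IsLagrangian ω L)
    (hM : M ≤ LinearMap.BilinForm.orthogonal ω M) (hML : M ⊓ L = ⊥)
    (h : LinearMap.BilinForm.orthogonal ω M ≤ M ⊔ L) : IsLagrangian ω M := by
  have hdisj : LinearMap.BilinForm.orthogonal ω M ⊓ L = ⊥ := by
    rw [eq_bot_iff, ← hML]
    refine le_inf ?_ inf_le_right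
    rw [← LinearMap.BilinForm.orthogonal_orthogonal hnd halt.isRefl M]
    rintro x ⟨hxM, hxL⟩ y hy
    rw [LinearMap.BilinForm.orthogonal_orthogonal hnd halt.isRefl M] at hxM
    obtain ⟨m, hm, l, hl, rfl⟩ := Submodule.mem_sup.1 (h hy)
    rw [← hL] at hxL
    have h1 : ω m x = 0 := hxM m hm
    have h2 : ω l x = 0 := hxL l hl
    simp [h1, h2]
  refine le_antisymm ?_ hM
  calc LinearMap.BilinForm.orthogonal ω M
      = (M ⊔ L) ⊓ LinearMap.BilinForm.orthogonal ω M := (inf_eq_right.2 h).symm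
    _ = M ⊔ L ⊓ LinearMap.BilinForm.orthogonal ω M := sup_inf_assoc_of_le L hM
    _ ≤ M := by rw [inf_comm L, hdisj, sup_bot_eq]

/-- Any two Lagrangian subspaces have a common Lagrangian complement. -/
theorem exists_isLagrangian_inf_eq_bot (halt : LinearMap.IsAlt ω)
    (hnd : LinearMap.BilinForm.Nondegenerate ω) {L1 L2 : Submodule ℝ E}
    (hL1 : IsLagrangian ω L1) (hL2 : IsLagrangian ω L2) :
    ∃ M, IsLagrangian ω M ∧ M ⊓ L1 = ⊥ ∧ M ⊓ L2 = ⊥ := by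
  obtain ⟨M, ⟨hM, hM1, hM2⟩, hmax⟩ := WellFounded.has_min
    (wellFounded_gt (α := Submodule ℝ E))
    {M | M ≤ LinearMap.BilinForm.orthogonal ω M ∧ M ⊓ L1 = ⊥ ∧ M ⊓ L2 = ⊥}
    ⟨⊥, bot_le, bot_inf_eq _, bot_inf_eq _⟩
  refine ⟨M, ?_, hM1, hM2⟩
  by_contra hlag
  obtain ⟨x, hx, hx1, hx2⟩ := Submodule.exists_mem_notMem_notMem
    (fun h => hlag (hL1.of_orthogonal_le_sup halt hnd hM hM1 h))
    (fun h => hlag (hL2.of_orthogonal_le_sup halt hnd hM hM2 h))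
  refine hmax (M ⊔ Submodule.span ℝ {x}) ⟨le_orthogonal_sup_span_singleton halt hM hx,
    Submodule.sup_span_singleton_inf_eq_bot hM1 hx1,
    Submodule.sup_span_singleton_inf_eq_bot hM2 hx2⟩ ?_
  refine lt_of_le_of_ne le_sup_left fun h => hx1 (Submodule.mem_sup_left ?_)
  rw [h]
  exact Submodule.mem_sup_right (Submodule.mem_span_singleton_self x)

/-- Transversality to a fixed subspace is an open condition along a path of Lagrangians. -/
theorem IsLagrangianPath.eventually_inf_eq_bot {a b : ℝ} {L : ℝ → Submodule ℝ E}
    (hL : IsLagrangianPath ω a b L) {M : Submodule ℝ E} {t₀ : ℝ} (ht₀ : t₀ ∈ Set.Icc a b)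
    (h : M ⊓ L t₀ = ⊥) : ∀ᶠ t in nhdsWithin t₀ (Set.Icc a b), M ⊓ L t = ⊥ := by
  obtain ⟨U, hU, hUsub, P, hP, hPL⟩ := hL.locTriv t₀ ht₀
  have hmem : ∀ t ∈ U, ∀ x, x ∈ L t ↔ P t x = x := by
    intro t ht x
    rw [← (hPL t ht).2]
    constructor
    · rintro ⟨y, rfl⟩
      exact congrArg (fun f => f y) (hPL t ht).1
    · exact fun hx => ⟨x, hx⟩
  have hiff : ∀ t ∈ U, M ⊓ L t = ⊥ ↔
      Function.Injective ((ContinuousLinearMap.id ℝ E - P t).comp M.subtypeL) := by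
    intro t ht
    rw [injective_iff_map_eq_zero, Submodule.eq_bot_iff]
    constructor
    · intro hbot x hx
      refine Subtype.ext (hbot x ⟨x.2, (hmem t ht x).2 ?_⟩)
      exact (sub_eq_zero.1 hx).symm
    · rintro hinj x ⟨hxM, hxL⟩
      exact congrArg Subtype.val (hinj ⟨x, hxM⟩ (sub_eq_zero.2 ((hmem t ht x).1 hxL).symm))
  have ht₀U : t₀ ∈ U := mem_of_mem_nhdsWithin ht₀ hU
  have hcont : ContinuousWithinAt
      (fun t => (ContinuousLinearMap.id ℝ E - P t).comp M.subtypeL) U t₀ :=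
    ((continuousOn_const.sub hP).clm_comp continuousOn_const) t₀ ht₀U
  have hev := (hcont.mono_of_mem_nhdsWithin hU).eventually_mem
    (ContinuousLinearMap.isOpen_injective.mem_nhds ((hiff t₀ ht₀U).1 h))
  filter_upwards [hev, hU] with t ht htU using (hiff t htU).2 ht

end Lagrangian

/-- existence of admissible data: for any two continuous paths of Lagrangian
subspaces on `[a,b]` there is a partition `a = t_0 ≤ … ≤ t_k = b` and Lagrangian subspaces
`M_1, …, M_k` with `M_ν ∩ L_i(t) = 0` for all `t ∈ [t_{ν-1}, t_ν]`, `i = 1,2`. -/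
theorem admissible_data_exists [FiniteDimensional ℝ E]
    (ω : BilinForm ℝ E) (halt : LinearMap.IsAlt ω)
    (hnd : LinearMap.BilinForm.Nondegenerate ω)
    (a b : ℝ) (hab : a ≤ b)
    (L1 L2 : ℝ → Submodule ℝ E)
    (h1 : IsLagrangianPath ω a b L1) (h2 : IsLagrangianPath ω a b L2) :
    Nonempty (AdmissibleData ω a b L1 L2) := by
  have hloc : ∀ s : Set.Icc a b, ∃ M, IsLagrangian ω M ∧
      ∀ᶠ t : Set.Icc a b in nhds s, M ⊓ L1 t = ⊥ ∧ M ⊓ L2 t = ⊥ := by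
    intro s
    obtain ⟨M, hM, hM1, hM2⟩ := exists_isLagrangian_inf_eq_bot halt hnd
      (h1.lag s s.2) (h2.lag s s.2)
    refine ⟨M, hM, ?_⟩
    rw [nhds_subtype_eq_comap_nhdsWithin]
    exact ((h1.eventually_inf_eq_bot s.2 hM1).and
      (h2.eventually_inf_eq_bot s.2 hM2)).comap Subtype.val
  choose M hM hMev using hloc
  obtain ⟨t, ht0, hmono, ⟨m, hm⟩, hsub⟩ := exists_monotone_Icc_subset_open_cover_Icc hab
    (c := fun s => interior {t : Set.Icc a b | M s ⊓ L1 t = ⊥ ∧ M s ⊓ L2 t = ⊥})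
    (fun _ => isOpen_interior)
    (fun s _ => Set.mem_iUnion.2 ⟨s, mem_interior_iff_mem_nhds.2 (hMev s)⟩)
  choose i hi using hsub
  have htrans : ∀ ν, ∀ s ∈ Set.Icc (t ν : ℝ) (t (ν + 1)),
      M (i ν) ⊓ L1 s = ⊥ ∧ M (i ν) ⊓ L2 s = ⊥ := by
    intro ν s hs
    have hs' : s ∈ Set.Icc a b := ⟨(t ν).2.1.trans hs.1, hs.2.trans (t (ν + 1)).2.2⟩
    have hmem : (⟨s, hs'⟩ : Set.Icc a b) ∈ Set.Icc (t ν) (t (ν + 1)) := ⟨hs.1, hs.2⟩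
    have hint := interior_subset (hi ν hmem)
    exact hint
  exact ⟨{
    k := m + 1
    kpos := m.succ_pos
    t := fun ν => t ν
    M := fun ν => M (i (ν - 1))
    ht0 := ht0
    htk := hm (m + 1) m.le_succ
    hmono := fun ν _ => hmono ν.le_succ
    hlag := fun ν _ => hM (i ν)
    htrans1 := fun ν _ s hs => (htrans ν s hs).1
    htrans2 := fun ν _ s hs => (htrans ν s hs).2 }⟩
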